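/- arXiv:2006.08953 — 3 statements merged into one kernel-verified Lean document; each statement's English description precedes it below -/
import Mathlib

section
/- Let X be a linear order whose strict order relation is well-founded (a well order), and let φ be an arbitrary predicate taking a natural number n, an element x of X, and a set Z ⊆ X × ℕ. If Y ⊆ X × ℕ satisfies H_φ(X,Y), then for every x ∈ X the restriction Y^x satisfies H_φ(X↾x, Y^x); moreover any set Z ⊆ X × ℕ with H_φ(X↾x, Z) equals Y^x. -/
/-- `H_φ(X↾x, Y)` restriction operation: `Y^x = {(x',n) ∈ Y | x' < x}`. -/
def restrictS {X : Type*} [LinearOrder X] (Z : Set (X × ℕ)) (x : X) : Set (X × ℕ) :=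
  {p ∈ Z | p.1 < x}

/-- `H_φ(X, Y)`: for all `x ∈ X` and `n ∈ ℕ`, `(x,n) ∈ Y ↔ φ(n, x, Y^x)`. -/
def Hfull {X : Type*} [LinearOrder X]
    (φ : ℕ → X → Set (X × ℕ) → Prop) (Y : Set (X × ℕ)) : Prop :=
  ∀ (x : X) (n : ℕ), (x, n) ∈ Y ↔ φ n x (restrictS Y x)

/-- `H_φ(X↾x, Z)`: `Z ⊆ {(x',n) | x' < x}` and for all `x' < x` and `n`,
`(x',n) ∈ Z ↔ φ(n, x', Z^{x'})`. -/
def Hres {X : Type*} [LinearOrder X]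
    (φ : ℕ → X → Set (X × ℕ) → Prop) (x : X) (Z : Set (X × ℕ)) : Prop :=
  (∀ p ∈ Z, p.1 < x) ∧
  ∀ (x' : X) (n : ℕ), x' < x → ((x', n) ∈ Z ↔ φ n x' (restrictS Z x'))

theorem restrictS_restrictS_of_le {X : Type*} [LinearOrder X] (Z : Set (X × ℕ)) {x' x : X}
    (h : x' ≤ x) : restrictS (restrictS Z x) x' = restrictS Z x' := by
  ext p
  exact ⟨fun hp => ⟨hp.1.1, hp.2⟩, fun hp => ⟨⟨hp.1, hp.2.trans_le h⟩, hp.2⟩⟩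

theorem Hfull.hres_restrictS {X : Type*} [LinearOrder X] {φ : ℕ → X → Set (X × ℕ) → Prop}
    {Y : Set (X × ℕ)} (hY : Hfull φ Y) (x : X) : Hres φ x (restrictS Y x) := by
  refine ⟨fun p hp => hp.2, fun x' n hx => ?_⟩
  rw [restrictS_restrictS_of_le Y hx.le, ← hY x' n]
  exact ⟨fun h => h.1, fun h => ⟨h, hx⟩⟩

theorem Hres.eq {X : Type*} [LinearOrder X] (hwf : WellFounded ((· < ·) : X → X → Prop))
    {φ : ℕ → X → Set (X × ℕ) → Prop} {x : X} {Z W : Set (X × ℕ)}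
    (hZ : Hres φ x Z) (hW : Hres φ x W) : Z = W := by
  have key : ∀ x' : X, x' < x → ∀ n : ℕ, (x', n) ∈ Z ↔ (x', n) ∈ W := by
    intro x'
    induction x' using hwf.induction with
    | _ x' ih =>
      intro hx n
      have h : restrictS Z x' = restrictS W x' := by
        ext ⟨y, m⟩
        exact and_congr_left fun hy => ih y hy (lt_trans hy hx) m
      rw [hZ.2 x' n hx, hW.2 x' n hx, h]
  ext ⟨y, m⟩
  exact ⟨fun h => (key y (hZ.1 _ h) m).1 h, fun h => (key y (hW.1 _ h) m).2 h⟩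

/-- if `H_φ(X,Y)` then every restriction `Y^x` satisfies `H_φ(X↾x, Y^x)`,
and any `Z` with `H_φ(X↾x, Z)` equals `Y^x`. -/
theorem stmt_1 {X : Type*} [LinearOrder X]
    (hwf : WellFounded ((· < ·) : X → X → Prop))
    (φ : ℕ → X → Set (X × ℕ) → Prop)
    (Y : Set (X × ℕ)) (hY : Hfull φ Y) :
    ∀ x : X, Hres φ x (restrictS Y x) ∧
      ∀ Z : Set (X × ℕ), Hres φ x Z → Z = restrictS Y x := by
  exact fun x => ⟨hY.hres_restrictS x, fun Z hZ => hZ.eq hwf (hY.hres_restrictS x)⟩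
end

section
/- If f is an x-approximation and g is an x-extension of f, then g is an x-approximation. -/
/-- A partial function `X × ℕ → Option Bool` is finite if its support is finite. -/
def FinSupp {X : Type*} (f : X × ℕ → Option Bool) : Prop :=
  {p | f p ≠ none}.Finite

/-- `f ⪯ g`: every defined value of `f` is a defined value of `g` with the same value. -/
def PLE {X : Type*} (f g : X × ℕ → Option Bool) : Prop :=
  ∀ p b, f p = some b → g p = some b

/-- `f ⪯ Z` for a set `Z ⊆ X × ℕ` (identified with its characteristic function). -/
def PLESet {X : Type*} (f : X × ℕ → Option Bool) (Z : Set (X × ℕ)) : Prop :=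
  ∀ p : X × ℕ, (f p = some true → p ∈ Z) ∧ (f p = some false → p ∉ Z)

/-- `f↾x`: restriction of `f` to arguments `(x',n)` with `x' < x`. -/
def restrictF {X : Type*} [LinearOrder X] (f : X × ℕ → Option Bool) (x : X) :
    X × ℕ → Option Bool :=
  fun p => if p.1 < x then f p else none

/-- `g` is an `x`-extension of `f`: `f ⪯ g` and whenever `g(x',n)` is defined but
`f(x',n)` is not, we have `x ≤ x'` and `g(x',n) = false`. -/
def IsExtension {X : Type*} [LinearOrder X] (x : X) (f g : X × ℕ → Option Bool) : Prop :=
  PLE f g ∧ ∀ p : X × ℕ, g p ≠ none → f p = none → x ≤ p.1 ∧ g p = some false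

/-- `f` is an `x`-approximation (relative to `φ₀` and `ψ₀`). -/
def IsApprox {X : Type*} [LinearOrder X]
    (φ₀ ψ₀ : ℕ → X → (X × ℕ → Option Bool) → Prop) (x : X)
    (f : X × ℕ → Option Bool) : Prop :=
  FinSupp f ∧
  (∀ (x' : X) (n : ℕ) (b : Bool), f (x', n) = some b → x ≤ x' → b = false) ∧
  (∀ (x' : X) (n : ℕ), x' < x → f (x', n) = some true →
    ∃ h, FinSupp h ∧ IsExtension x' (restrictF f x') h ∧ φ₀ n x' h) ∧
  (∀ (x' : X) (n : ℕ), x' < x → f (x', n) = some false →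
    ∃ h, FinSupp h ∧ IsExtension x' (restrictF f x') h ∧ ψ₀ n x' h)

/-- `φ(n,x,Z)`: there is a finite partial function `f ⪯ Z` with `φ₀(n,x,f)`. -/
def phi {X : Type*} (φ₀ : ℕ → X → (X × ℕ → Option Bool) → Prop)
    (n : ℕ) (x : X) (Z : Set (X × ℕ)) : Prop :=
  ∃ f, FinSupp f ∧ PLESet f Z ∧ φ₀ n x f

/-- The premise of effective transfinite recursion. -/
def ETRPremise {X : Type*} [LinearOrder X]
    (φ₀ ψ₀ : ℕ → X → (X × ℕ → Option Bool) → Prop) : Prop :=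
  ∀ (x : X) (Z : Set (X × ℕ)), Hres (phi φ₀) x Z →
    ∀ n : ℕ, (phi φ₀ n x Z ↔ ¬ phi ψ₀ n x Z)

theorem IsExtension.apply_eq_of_lt {X : Type*} [LinearOrder X] {x : X}
    {f g : X × ℕ → Option Bool} (h : IsExtension x f g) {p : X × ℕ} (hp : p.1 < x) :
    g p = f p := by
  cases hfp : f p with
  | some b => exact h.1 p b hfp
  | none =>
    by_contra hgp
    exact hp.not_ge (h.2 p hgp hfp).1

theorem IsExtension.restrictF_eq {X : Type*} [LinearOrder X] {x x' : X}
    {f g : X × ℕ → Option Bool} (h : IsExtension x f g) (hx : x' ≤ x) :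
    restrictF g x' = restrictF f x' := by
  funext p
  unfold restrictF
  split_ifs with hp
  · exact h.apply_eq_of_lt (hp.trans_le hx)
  · rfl

/-- if `f` is an `x`-approximation and `g` is a finite partial function
that is an `x`-extension of `f`, then `g` is an `x`-approximation. -/
theorem stmt_3 {X : Type*} [LinearOrder X]
    (hwf : WellFounded ((· < ·) : X → X → Prop))
    (φ₀ ψ₀ : ℕ → X → (X × ℕ → Option Bool) → Prop)
    (hφmono : ∀ (n : ℕ) (x : X) (f g : X × ℕ → Option Bool),
      FinSupp f → FinSupp g → φ₀ n x f → PLE f g → φ₀ n x g)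
    (hψmono : ∀ (n : ℕ) (x : X) (f g : X × ℕ → Option Bool),
      FinSupp f → FinSupp g → ψ₀ n x f → PLE f g → ψ₀ n x g)
    (x : X) (f g : X × ℕ → Option Bool)
    (hf : IsApprox φ₀ ψ₀ x f) (hgfin : FinSupp g) (hext : IsExtension x f g) :
    IsApprox φ₀ ψ₀ x g := by
  obtain ⟨-, hfalse, hφ, hψ⟩ := hf
  refine ⟨hgfin, fun x' n b hb hx => ?_, fun x' n hx hg => ?_, fun x' n hx hg => ?_⟩
  · cases hfp : f (x', n) with
    | some c =>
      have hc := hext.1 _ _ hfp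
      rw [hb, Option.some_inj] at hc
      exact hc ▸ hfalse x' n c hfp hx
    | none =>
      have hc := (hext.2 (x', n) (by simp [hb]) hfp).2
      rwa [hb, Option.some_inj] at hc
  · rw [hext.restrictF_eq hx.le]
    exact hφ x' n hx (hext.apply_eq_of_lt (p := (x', n)) hx ▸ hg)
  · rw [hext.restrictF_eq hx.le]
    exact hψ x' n hx (hext.apply_eq_of_lt (p := (x', n)) hx ▸ hg)
end

section
/- Assume the ETR premise. Then for every x ∈ X, every x-approximation h and every n ∈ ℕ, there is an x-approximation f with h ⪯ f such that φ₀(n,x,f) or ψ₀(n,x,f) holds. -/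
/-- The hierarchy defined by transfinite recursion along a well-founded order exists. -/
theorem exists_Hfull {X : Type*} [LinearOrder X]
    (hwf : WellFounded ((· < ·) : X → X → Prop))
    (φ : ℕ → X → Set (X × ℕ) → Prop) : ∃ Z : Set (X × ℕ), Hfull φ Z := by
  let F : ∀ x : X, (∀ y, y < x → ℕ → Prop) → ℕ → Prop :=
    fun x IH n => φ n x {p | ∃ h : p.1 < x, IH p.1 h p.2}
  refine ⟨{p | hwf.fix F p.1 p.2}, fun x n => ?_⟩
  have hset : restrictS {p : X × ℕ | hwf.fix F p.1 p.2} x =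
      {p | ∃ _ : p.1 < x, hwf.fix F p.1 p.2} := by
    ext p
    simp [restrictS, and_comm]
  rw [hset, Set.mem_ofPred_eq, hwf.fix_eq]

theorem restrictS_restrictS {X : Type*} [LinearOrder X] (Z : Set (X × ℕ)) {x y : X}
    (h : y < x) : restrictS (restrictS Z x) y = restrictS Z y := by
  ext p
  simp only [restrictS, Set.mem_ofPred_eq]
  exact ⟨fun hp => ⟨hp.1.1, hp.2⟩, fun hp => ⟨⟨hp.1, hp.2.trans h⟩, hp.2⟩⟩

theorem Hfull.hres {X : Type*} [LinearOrder X] {φ : ℕ → X → Set (X × ℕ) → Prop}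
    {Z : Set (X × ℕ)} (hZ : Hfull φ Z) (x : X) : Hres φ x (restrictS Z x) := by
  refine ⟨fun p hp => hp.2, fun y n hy => ?_⟩
  rw [restrictS_restrictS Z hy, ← hZ y n]
  exact ⟨fun h => h.1, fun h => ⟨h, hy⟩⟩

/-- An extension at level `x` of a part of `Z` below `x` is compatible with `Z^x`. -/
theorem IsExtension.pleSet {X : Type*} [LinearOrder X] {Z : Set (X × ℕ)} {x : X}
    {f h : X × ℕ → Option Bool} (hext : IsExtension x (restrictF f x) h)
    (hf : ∀ p : X × ℕ, p.1 < x → ∀ b, f p = some b → (b = true ↔ p ∈ Z)) :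
    PLESet h (restrictS Z x) := by
  have key : ∀ p b, h p = some b → (b = true ↔ p ∈ restrictS Z x) := by
    intro p b hb
    cases hr : restrictF f x p with
    | none =>
      obtain ⟨hx, hfalse⟩ := hext.2 p (by simp [hb]) hr
      have hb' : b = false := by simpa [hb] using hfalse
      simp [restrictS, hb', hx]
    | some c =>
      have hc : b = c := by
        have := hext.1 p c hr
        simpa [hb] using this
      have hp : p.1 < x := by
        by_contra hn
        simp [restrictF, hn] at hr
      rw [restrictF, if_pos hp] at hr
      rw [hc, hf p hp c hr]
      exact ⟨fun h => ⟨h, hp⟩, fun h => h.1⟩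
  exact fun p => ⟨fun hp => (key p _ hp).1 rfl,
    fun hp hm => Bool.false_ne_true ((key p _ hp).2 hm)⟩

/-- Under the ETR premise, approximations are compatible with the true hierarchy. -/
theorem IsApprox.pleSet {X : Type*} [LinearOrder X]
    (hwf : WellFounded ((· < ·) : X → X → Prop))
    {φ₀ ψ₀ : ℕ → X → (X × ℕ → Option Bool) → Prop} (hprem : ETRPremise φ₀ ψ₀)
    {Z : Set (X × ℕ)} (hZ : Hfull (phi φ₀) Z) {x : X} {f : X × ℕ → Option Bool}
    (hf : IsApprox φ₀ ψ₀ x f) : PLESet f (restrictS Z x) := by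
  obtain ⟨-, hge, htrue, hfalse⟩ := hf
  have key : ∀ y : X, y < x → ∀ n b, f (y, n) = some b → (b = true ↔ (y, n) ∈ Z) := by
    intro y
    induction y using hwf.induction with
    | _ y ih =>
      intro hy n b hb
      have hbelow : ∀ p : X × ℕ, p.1 < y → ∀ b, f p = some b → (b = true ↔ p ∈ Z) :=
        fun p hp b hpb => ih p.1 hp (hp.trans hy) p.2 b hpb
      rw [hZ y n]
      cases b with
      | true =>
        obtain ⟨h, hfin, hext, hφ⟩ := htrue y n hy hb
        exact ⟨fun _ => ⟨h, hfin, hext.pleSet hbelow, hφ⟩, fun _ => rfl⟩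
      | false =>
        obtain ⟨h, hfin, hext, hψ⟩ := hfalse y n hy hb
        refine ⟨fun h => (Bool.false_ne_true h).elim, fun hφ => ?_⟩
        exact ((hprem y _ (hZ.hres y) n).1 hφ ⟨h, hfin, hext.pleSet hbelow, hψ⟩).elim
  intro p
  rcases lt_or_ge p.1 x with hp | hp
  · refine ⟨fun h => ⟨(key p.1 hp p.2 _ h).1 rfl, hp⟩, fun h hm => ?_⟩
    exact Bool.false_ne_true ((key p.1 hp p.2 _ h).2 hm.1)
  · exact ⟨fun h => (Bool.false_ne_true (hge p.1 p.2 _ h hp).symm).elim,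
      fun _ hm => hp.not_gt hm.2⟩

/-- A finite set is contained in a finite set closed under finitely many smaller dependencies. -/
theorem exists_finite_closed_superset {X : Type*} [LinearOrder X]
    (hwf : WellFounded ((· < ·) : X → X → Prop)) (D : X × ℕ → Set (X × ℕ))
    (hD : ∀ p, (D p).Finite) {A : Set (X × ℕ)} (hA : A.Finite) :
    ∃ S : Set (X × ℕ), S.Finite ∧ A ⊆ S ∧ ∀ p ∈ S, ∀ q ∈ D p, q.1 < p.1 → q ∈ S := by
  have point : ∀ x : X, ∀ n : ℕ, ∃ S : Set (X × ℕ), S.Finite ∧ (x, n) ∈ S ∧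
      ∀ p ∈ S, ∀ q ∈ D p, q.1 < p.1 → q ∈ S := by
    intro x
    induction x using hwf.induction with
    | _ x ih =>
      intro n
      choose! S hfin hmem hcl using ih
      refine ⟨insert (x, n) (⋃ q ∈ {q ∈ D (x, n) | q.1 < x}, S q.1 q.2), ?_,
        Set.mem_insert _ _, ?_⟩
      · exact (((hD (x, n)).subset (Set.sep_subset _ _)).biUnion
          fun q hq => hfin q.1 hq.2 q.2).insert _
      · rintro p (rfl | hp) q hq hlt
        · exact Or.inr (Set.mem_biUnion (x := q) ⟨hq, hlt⟩ (hmem q.1 hlt q.2))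
        · obtain ⟨r, hr, hpr⟩ := Set.mem_iUnion₂.1 hp
          exact Or.inr (Set.mem_biUnion hr (hcl r.1 hr.2 r.2 p hpr q hq hlt))
  choose S hfin hmem hcl using point
  refine ⟨⋃ p ∈ A, S p.1 p.2, hA.biUnion fun p _ => hfin p.1 p.2,
    fun p hp => Set.mem_biUnion hp (hmem p.1 p.2), fun p hp q hq hlt => ?_⟩
  obtain ⟨r, hr, hpr⟩ := Set.mem_iUnion₂.1 hp
  exact Set.mem_biUnion hr (hcl r.1 r.2 p hpr q hq hlt)

open Classical in
/-- The characteristic function of `Z`, as a partial function with domain `S`. -/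
noncomputable def charOn {X : Type*} (Z S : Set (X × ℕ)) : X × ℕ → Option Bool :=
  fun p => if p ∈ S then some (decide (p ∈ Z)) else none

theorem charOn_eq_some {X : Type*} {Z S : Set (X × ℕ)} {p : X × ℕ} {b : Bool} :
    charOn Z S p = some b ↔ p ∈ S ∧ (b = true ↔ p ∈ Z) := by
  cases b <;> simp [charOn]

theorem charOn_eq_none {X : Type*} {Z S : Set (X × ℕ)} {p : X × ℕ} :
    charOn Z S p = none ↔ p ∉ S := by
  simp [charOn]

theorem finSupp_charOn {X : Type*} {Z S : Set (X × ℕ)} (hS : S.Finite) :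
    FinSupp (charOn Z S) :=
  hS.subset fun p hp => by simpa [charOn_eq_none] using hp

theorem PLESet.ple_charOn {X : Type*} {Z S : Set (X × ℕ)} {f : X × ℕ → Option Bool}
    (hf : PLESet f Z) (hS : {p | f p ≠ none} ⊆ S) : PLE f (charOn Z S) := by
  intro p b hb
  refine charOn_eq_some.2 ⟨hS (by simp [hb]), ?_⟩
  cases b with
  | true => simpa using (hf p).1 hb
  | false => simpa using (hf p).2 hb

theorem isExtension_charOn {X : Type*} [LinearOrder X] {Z S D : Set (X × ℕ)} {x y : X}
    (hyx : y < x) (hD : ∀ q ∈ D, q.1 < y → q ∈ S) :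
    IsExtension y (restrictF (charOn (restrictS Z x) S) y)
      (charOn (restrictS Z y) ({q ∈ S | q.1 < y} ∪ D)) := by
  refine ⟨fun q b hb => ?_, fun q hq hnone => ?_⟩
  · have hqy : q.1 < y := by
      by_contra hn
      simp [restrictF, hn] at hb
    rw [restrictF, if_pos hqy, charOn_eq_some] at hb
    refine charOn_eq_some.2 ⟨Or.inl ⟨hb.1, hqy⟩, hb.2.trans ?_⟩
    simp [restrictS, hqy, hqy.trans hyx]
  · have hmem : q ∈ {q ∈ S | q.1 < y} ∪ D := by
      by_contra hn
      exact hq (charOn_eq_none.2 hn)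
    have hge : y ≤ q.1 := by
      by_contra hn
      have hqy := not_le.1 hn
      rw [restrictF, if_pos hqy, charOn_eq_none] at hnone
      exact hnone (hmem.elim (fun h => h.1) fun h => hD q h hqy)
    exact ⟨hge, charOn_eq_some.2 ⟨hmem, by simp [restrictS, hge]⟩⟩

/-- under the ETR premise, any `x`-approximation `h` extends to an
`x`-approximation `f` with `φ₀(n,x,f)` or `ψ₀(n,x,f)`. -/
theorem stmt_5 {X : Type*} [LinearOrder X]
    (hwf : WellFounded ((· < ·) : X → X → Prop))
    (φ₀ ψ₀ : ℕ → X → (X × ℕ → Option Bool) → Prop)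
    (hφmono : ∀ (n : ℕ) (x : X) (f g : X × ℕ → Option Bool),
      FinSupp f → FinSupp g → φ₀ n x f → PLE f g → φ₀ n x g)
    (hψmono : ∀ (n : ℕ) (x : X) (f g : X × ℕ → Option Bool),
      FinSupp f → FinSupp g → ψ₀ n x f → PLE f g → ψ₀ n x g)
    (hprem : ETRPremise φ₀ ψ₀) :
    ∀ (x : X) (h : X × ℕ → Option Bool) (n : ℕ), IsApprox φ₀ ψ₀ x h →
      ∃ f : X × ℕ → Option Bool,
        IsApprox φ₀ ψ₀ x f ∧ PLE h f ∧ (φ₀ n x f ∨ ψ₀ n x f) := by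
  intro x h n hh
  obtain ⟨Z, hZ⟩ := exists_Hfull hwf (phi φ₀)
  have hwit : ∀ p : X × ℕ, ∃ g, FinSupp g ∧ PLESet g (restrictS Z p.1) ∧
      (p ∈ Z → φ₀ p.2 p.1 g) ∧ (p ∉ Z → ψ₀ p.2 p.1 g) := by
    intro p
    have hmem : p ∈ Z ↔ phi φ₀ p.2 p.1 (restrictS Z p.1) := hZ p.1 p.2
    by_cases hp : p ∈ Z
    · obtain ⟨g, hfin, hle, hg⟩ := hmem.1 hp
      exact ⟨g, hfin, hle, fun _ => hg, fun hn => (hn hp).elim⟩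
    · have hψ : phi ψ₀ p.2 p.1 (restrictS Z p.1) := by
        by_contra hn
        exact hp (hmem.2 ((hprem p.1 _ (hZ.hres p.1) p.2).2 hn))
      obtain ⟨g, hfin, hle, hg⟩ := hψ
      exact ⟨g, hfin, hle, fun hm => (hp hm).elim, fun _ => hg⟩
  choose g hgfin hgle hgφ hgψ using hwit
  obtain ⟨S, hSfin, hAS, hScl⟩ := exists_finite_closed_superset hwf
    (fun p => {q | g p q ≠ none}) hgfin (hh.1.union (hgfin (x, n)))
  have hext : ∀ (y : X) (m : ℕ), y < x → (y, m) ∈ S →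
      ∃ k, FinSupp k ∧ IsExtension y (restrictF (charOn (restrictS Z x) S) y) k ∧
        PLE (g (y, m)) k := fun y m hy hm =>
    ⟨_, finSupp_charOn ((hSfin.subset (Set.sep_subset _ _)).union (hgfin (y, m))),
      isExtension_charOn hy (hScl (y, m) hm),
      (hgle (y, m)).ple_charOn Set.subset_union_right⟩
  have hgf : PLE (g (x, n)) (charOn (restrictS Z x) S) :=
    (hgle (x, n)).ple_charOn (Set.subset_union_right.trans hAS)
  have hfin : FinSupp (charOn (restrictS Z x) S) := finSupp_charOn hSfin
  refine ⟨charOn (restrictS Z x) S, ⟨hfin, ?_, ?_, ?_⟩,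
    (hh.pleSet hwf hprem hZ).ple_charOn (Set.subset_union_left.trans hAS), ?_⟩
  · intro y m b hb hy
    have hiff := (charOn_eq_some.1 hb).2
    cases b with
    | false => rfl
    | true => exact (hy.not_gt (hiff.1 rfl).2).elim
  · intro y m hy hb
    obtain ⟨hS, hiff⟩ := charOn_eq_some.1 hb
    obtain ⟨k, hk, hke, hgk⟩ := hext y m hy hS
    exact ⟨k, hk, hke, hφmono m y _ k (hgfin _) hk (hgφ (y, m) (hiff.1 rfl).1) hgk⟩
  · intro y m hy hb
    obtain ⟨hS, hiff⟩ := charOn_eq_some.1 hb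
    obtain ⟨k, hk, hke, hgk⟩ := hext y m hy hS
    have hm : (y, m) ∉ Z := fun hm => Bool.false_ne_true (hiff.2 ⟨hm, hy⟩)
    exact ⟨k, hk, hke, hψmono m y _ k (hgfin _) hk (hgψ (y, m) hm) hgk⟩
  · by_cases hm : (x, n) ∈ Z
    · exact Or.inl (hφmono n x _ _ (hgfin _) hfin (hgφ (x, n) hm) hgf)
    · exact Or.inr (hψmono n x _ _ (hgfin _) hfin (hgψ (x, n) hm) hgf)
end
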